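/- Let B be a unital complex Banach algebra with ‖1‖ = 1. Let E₁ and E₂ be norm-closed subalgebras of B containing the unit of B, and suppose each Eᵢ is equipped with an involution x ↦ x⋆ⁱ (a conjugate-linear map with (x⋆ⁱ)⋆ⁱ = x and (x·y)⋆ⁱ = y⋆ⁱ·x⋆ⁱ) satisfying the C*-identity ‖x⋆ⁱ·x‖ = ‖x‖² for all x, y ∈ Eᵢ, so that each Eᵢ, with the norm and algebraic operations inherited from B, is a unital C*-algebra. Then the two involutions agree on the intersection: for every x ∈ E₁ ∩ E₂ one has x⋆¹ = x⋆². -/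

import Mathlib

open Complex in
/-- A self-adjoint element of a C*-subalgebra satisfies `‖1 + i t a‖ ≤ 1 + t² ‖a‖²`. -/
theorem herm_bound {B : Type*} [NormedRing B] [NormedAlgebra ℂ B] [NormOneClass B]
    (E : Subalgebra ℂ B) (s : B → B)
    (mem : ∀ x ∈ E, s x ∈ E)
    (add : ∀ x ∈ E, ∀ y ∈ E, s (x + y) = s x + s y)
    (smul : ∀ (c : ℂ), ∀ x ∈ E, s (c • x) = star c • s x)
    (inv : ∀ x ∈ E, s (s x) = x)
    (mul : ∀ x ∈ E, ∀ y ∈ E, s (x * y) = s y * s x)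
    (cstar : ∀ x ∈ E, ‖s x * x‖ = ‖x‖ ^ 2)
    (a : B) (ha : a ∈ E) (hs : s a = a) (t : ℝ) :
    ‖1 + ((t : ℂ) * I) • a‖ ≤ 1 + t ^ 2 * ‖a‖ ^ 2 := by
  have h1 : s 1 = 1 := by
    have h := mul (s 1) (mem 1 E.one_mem) 1 E.one_mem
    rw [mul_one, inv 1 E.one_mem, mul_one] at h
    exact h.symm
  have hm : ((t : ℂ) * I) • a ∈ E := E.smul_mem ha _
  have h2 := cstar (1 + ((t : ℂ) * I) • a) (E.add_mem E.one_mem hm)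
  rw [add 1 E.one_mem _ hm, smul _ a ha, h1, hs] at h2
  have h3 : (1 + star ((t : ℂ) * I) • a) * (1 + ((t : ℂ) * I) • a)
      = 1 + ((t : ℂ) ^ 2) • (a * a) := by
    have e : star ((t : ℂ) * I) = -((t : ℂ) * I) := by simp
    rw [e, mul_add, add_mul, add_mul, smul_mul_smul_comm]
    have e2 : -((t : ℂ) * I) * ((t : ℂ) * I) = (t : ℂ) ^ 2 := by
      linear_combination (-(t : ℂ) ^ 2) * I_sq
    rw [e2]
    simp only [mul_one, one_mul, neg_smul]
    abel
  rw [h3] at h2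
  have h4 : ‖(1 : B) + ((t : ℂ) ^ 2) • (a * a)‖ ≤ 1 + t ^ 2 * ‖a‖ ^ 2 := by
    refine (norm_add_le _ _).trans ?_
    rw [norm_one, norm_smul]
    have e3 : ‖(t : ℂ) ^ 2‖ = t ^ 2 := by simp
    rw [e3, pow_two ‖a‖]
    gcongr
    exact norm_mul_le _ _
  have h5 : 0 ≤ t ^ 2 * ‖a‖ ^ 2 := by positivity
  rw [h2] at h4
  nlinarith [norm_nonneg ((1 : B) + ((t : ℂ) * I) • a)]

/-- If `‖1 + z h‖ ≤ 1 + C |z|²` for all complex `z`, then `h = 0`. -/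
theorem eq_zero_of_bound {B : Type*} [NormedRing B] [NormedAlgebra ℂ B] [CompleteSpace B]
    [NormOneClass B] (h : B) (C : ℝ)
    (hC : ∀ z : ℂ, ‖1 + z • h‖ ≤ 1 + C * ‖z‖ ^ 2) : h = 0 := by
  have key : ∀ m : ℕ, 0 < m → ‖h‖ ≤ Real.exp C / m := by
    intro m hm
    have hm' : (0 : ℝ) < m := by exact_mod_cast hm
    set q : ℂ → B := fun z => (1 + (z / (m : ℂ) ^ 2) • h) ^ (m ^ 2) with hq
    have hd : Differentiable ℂ q := by
      intro z
      apply DifferentiableAt.pow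
      fun_prop
    have hder : HasDerivAt q h 0 := by
      have h0 : HasDerivAt (fun z : ℂ => 1 + (z / (m : ℂ) ^ 2) • h)
          ((1 / (m : ℂ) ^ 2) • h) 0 :=
        (((hasDerivAt_id (0 : ℂ)).div_const _).smul_const h).const_add 1
      have := h0.fun_pow' (m ^ 2)
      convert this using 1
      have hmc : (m : ℂ) ≠ 0 := by exact_mod_cast hm.ne'
      simp [← Nat.cast_smul_eq_nsmul ℂ, smul_smul, hmc]
    have hb := Complex.norm_deriv_le_of_forall_mem_sphere_norm_le (f := q) (c := 0)
      (R := m) (C := Real.exp C) hm' hd.diffContOnCl ?_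
    · rwa [hder.deriv] at hb
    · intro z hz
      have hz' : ‖z‖ = m := by simpa using hz
      have h1 := hC (z / (m : ℂ) ^ 2)
      have h2 : ‖z / (m : ℂ) ^ 2‖ ^ 2 = 1 / (m : ℝ) ^ 2 := by
        rw [norm_div, hz', norm_pow, Complex.norm_natCast]
        field_simp
      rw [h2] at h1
      calc ‖q z‖ ≤ ‖1 + (z / (m : ℂ) ^ 2) • h‖ ^ (m ^ 2) := norm_pow_le _ _
        _ ≤ (Real.exp (C * (1 / (m : ℝ) ^ 2))) ^ (m ^ 2) := by
          gcongr
          refine h1.trans ?_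
          rw [add_comm]
          exact Real.add_one_le_exp _
        _ = Real.exp C := by
          rw [← Real.exp_nat_mul]
          congr 1
          push_cast
          field_simp
  have hlim := tendsto_const_div_atTop_nhds_zero_nat (Real.exp C)
  have : ‖h‖ ≤ 0 := by
    refine ge_of_tendsto hlim ?_
    filter_upwards [Filter.eventually_gt_atTop 0] with m hm using key m hm
  exact norm_le_zero_iff.mp this

/-- Two C*-involutions on closed unital subalgebras of a unital Banach algebra
(with ‖1‖ = 1) agree on the intersection of the subalgebras. -/
theorem stmt2 (B : Type*)
    [NormedRing B] [NormedAlgebra ℂ B] [CompleteSpace B] [NormOneClass B]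
    (E₁ E₂ : Subalgebra ℂ B)
    (hcl₁ : IsClosed (E₁ : Set B)) (hcl₂ : IsClosed (E₂ : Set B))
    (s₁ s₂ : B → B)
    -- s₁ is a C*-involution on E₁
    (mem₁ : ∀ x ∈ E₁, s₁ x ∈ E₁)
    (add₁ : ∀ x ∈ E₁, ∀ y ∈ E₁, s₁ (x + y) = s₁ x + s₁ y)
    (smul₁ : ∀ (c : ℂ), ∀ x ∈ E₁, s₁ (c • x) = star c • s₁ x)
    (inv₁ : ∀ x ∈ E₁, s₁ (s₁ x) = x)
    (mul₁ : ∀ x ∈ E₁, ∀ y ∈ E₁, s₁ (x * y) = s₁ y * s₁ x)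
    (cstar₁ : ∀ x ∈ E₁, ‖s₁ x * x‖ = ‖x‖ ^ 2)
    -- s₂ is a C*-involution on E₂
    (mem₂ : ∀ x ∈ E₂, s₂ x ∈ E₂)
    (add₂ : ∀ x ∈ E₂, ∀ y ∈ E₂, s₂ (x + y) = s₂ x + s₂ y)
    (smul₂ : ∀ (c : ℂ), ∀ x ∈ E₂, s₂ (c • x) = star c • s₂ x)
    (inv₂ : ∀ x ∈ E₂, s₂ (s₂ x) = x)
    (mul₂ : ∀ x ∈ E₂, ∀ y ∈ E₂, s₂ (x * y) = s₂ y * s₂ x)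
    (cstar₂ : ∀ x ∈ E₂, ‖s₂ x * x‖ = ‖x‖ ^ 2) :
    ∀ x, x ∈ E₁ → x ∈ E₂ → s₁ x = s₂ x := by
  intro x hx1 hx2
  have A1 : ∀ (E : Subalgebra ℂ B) (s : B → B), (∀ x ∈ E, s x ∈ E) →
      (∀ x ∈ E, ∀ y ∈ E, s (x + y) = s x + s y) →
      (∀ (c : ℂ), ∀ x ∈ E, s (c • x) = star c • s x) →
      (∀ x ∈ E, s (s x) = x) → x ∈ E →
      (x + s x ∈ E ∧ s (x + s x) = x + s x) ∧
      (Complex.I • (x - s x) ∈ E ∧ s (Complex.I • (x - s x)) = Complex.I • (x - s x)) := by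
    intro E s mem add smul inv hx
    have hsx := mem x hx
    refine ⟨⟨E.add_mem hx hsx, ?_⟩, E.smul_mem (E.sub_mem hx hsx) _, ?_⟩
    · rw [add _ hx _ hsx, inv x hx, add_comm]
    · have e : x - s x = x + (-1 : ℂ) • s x := by
        rw [neg_one_smul, sub_eq_add_neg]
      rw [smul _ _ (E.sub_mem hx hsx), e, add _ hx _ (E.smul_mem hsx _), smul _ _ hsx, inv x hx]
      simp [add_comm]
  obtain ⟨⟨ha1, sa1⟩, hb1, sb1⟩ := A1 E₁ s₁ mem₁ add₁ smul₁ inv₁ hx1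
  obtain ⟨⟨ha2, sa2⟩, hb2, sb2⟩ := A1 E₂ s₂ mem₂ add₂ smul₂ inv₂ hx2
  have Ba1 := herm_bound E₁ s₁ mem₁ add₁ smul₁ inv₁ mul₁ cstar₁ _ ha1 sa1
  have Bb1 := herm_bound E₁ s₁ mem₁ add₁ smul₁ inv₁ mul₁ cstar₁ _ hb1 sb1
  have Ba2 := herm_bound E₂ s₂ mem₂ add₂ smul₂ inv₂ mul₂ cstar₂ _ ha2 sa2
  have Bb2 := herm_bound E₂ s₂ mem₂ add₂ smul₂ inv₂ mul₂ cstar₂ _ hb2 sb2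
  rw [← sub_eq_zero]
  set N1 := ‖x + s₁ x‖ ^ 2 with hN1
  set N2 := ‖x + s₂ x‖ ^ 2 with hN2
  set M1 := ‖Complex.I • (x - s₁ x)‖ ^ 2 with hM1
  set M2 := ‖Complex.I • (x - s₂ x)‖ ^ 2 with hM2
  have p1 : 0 ≤ N1 := by positivity
  have p2 : 0 ≤ N2 := by positivity
  have p3 : 0 ≤ M1 := by positivity
  have p4 : 0 ≤ M2 := by positivity
  refine eq_zero_of_bound _ (4 * (N1 + N2 + M1 + M2)) ?_
  intro z
  have b1 := Ba1 (4 * z.im)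
  have b2 := Ba2 (-(4 * z.im))
  have b3 := Bb1 (4 * z.re)
  have b4 := Bb2 (-(4 * z.re))
  set w1 := 1 + (((4 * z.im : ℝ) : ℂ) * Complex.I) • (x + s₁ x)
  set w2 := 1 + (((-(4 * z.im) : ℝ) : ℂ) * Complex.I) • (x + s₂ x)
  set w3 := 1 + (((4 * z.re : ℝ) : ℂ) * Complex.I) • (Complex.I • (x - s₁ x))
  set w4 := 1 + (((-(4 * z.re) : ℝ) : ℂ) * Complex.I) • (Complex.I • (x - s₂ x))
  have hw : 1 + z • (s₁ x - s₂ x) = (1 / 4 : ℂ) • (w1 + w2 + w3 + w4) := by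
    conv_lhs => rw [← Complex.re_add_im z]
    simp only [w1, w2, w3, w4, smul_smul, mul_assoc, Complex.I_mul_I]
    push_cast
    module
  have hn : ‖1 + z • (s₁ x - s₂ x)‖ ≤ (1 / 4) * (‖w1‖ + ‖w2‖ + ‖w3‖ + ‖w4‖) := by
    rw [hw, norm_smul]
    have : ‖(1 / 4 : ℂ)‖ = 1 / 4 := by norm_num
    rw [this]
    gcongr
    exact norm_add₄_le
  have hz : ‖z‖ ^ 2 = z.re ^ 2 + z.im ^ 2 := by
    rw [Complex.sq_norm, Complex.normSq_apply]; ring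
  rw [hz]
  have q1 := mul_nonneg (sq_nonneg z.re) p1
  have q2 := mul_nonneg (sq_nonneg z.re) p2
  have q3 := mul_nonneg (sq_nonneg z.im) p3
  have q4 := mul_nonneg (sq_nonneg z.im) p4
  nlinarith
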